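/- Let N ≤ L be positive integers, let B_k, B_j ∈ ℂ^{L×N} satisfy B_kᴴB_k = L·I_N, let D ∈ ℂ^{N×N} be an invertible diagonal matrix, and let Σ_g, Σ_r ∈ ℂ^{N×N} with Σ_g Hermitian positive definite and Σ_r Hermitian positive semidefinite. Then, writing M = B_k·D·Σ_g·Dᴴ·B_kᴴ, the limit as ε → 0⁺ of Σ_g·Dᴴ·B_kᴴ·(M + ε·I_L)⁻¹·B_j·Σ_r·B_jᴴ·(M + ε·I_L)⁻¹·B_k·D·Σ_g exists and equals (1/L²)·D⁻¹·B_kᴴ·B_j·Σ_r·B_jᴴ·B_k·D^{−ᴴ}, where D^{−ᴴ} = (Dᴴ)⁻¹. In particular, if B_kᴴB_j = 0 the limit is the zero matrix, and if B_j = B_k the limit equals D⁻¹·Σ_r·D^{−ᴴ}. -/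

import Mathlib

open Matrix
open scoped ComplexOrder

namespace Matrix

variable {m n : Type*} [Fintype m] [DecidableEq m] [Fintype n] [DecidableEq n]

theorem mul_inv_eq_inv_mul_of_mul_eq_mul {X : Matrix m m ℂ} {Y : Matrix n n ℂ}
    {C : Matrix n m ℂ} (hX : IsUnit X.det) (hY : IsUnit Y.det) (h : C * X = Y * C) :
    C * X⁻¹ = Y⁻¹ * C := by
  rw [← nonsing_inv_mul_cancel_left Y (C * X⁻¹) hY, ← Matrix.mul_assoc Y, ← h,
    mul_nonsing_inv_cancel_right X C hX]

theorem PosSemidef.isUnit_det_add_smul_one {A : Matrix n n ℂ} (hA : A.PosSemidef)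
    {ε : ℝ} (hε : 0 < ε) : IsUnit (A + (ε : ℂ) • (1 : Matrix n n ℂ)).det := by
  have hε' : (0 : ℂ) < ε := by exact_mod_cast hε
  exact (PosDef.posSemidef_add hA (PosDef.one.smul hε')).det_pos.ne'.isUnit

/-- Push-through identity for a matrix `B` whose columns are orthogonal of equal squared norm. -/
theorem conjTranspose_mul_add_smul_one {B : Matrix m n ℂ} {c : ℂ}
    (hB : Bᴴ * B = c • (1 : Matrix n n ℂ)) (S : Matrix n n ℂ) (z : ℂ) :
    Bᴴ * (B * S * Bᴴ + z • (1 : Matrix m m ℂ)) = (c • S + z • (1 : Matrix n n ℂ)) * Bᴴ := by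
  simp only [Matrix.mul_add, Matrix.add_mul, ← Matrix.mul_assoc, hB, Matrix.smul_mul,
    Matrix.mul_smul, Matrix.one_mul, Matrix.mul_one]

theorem add_smul_one_mul {B : Matrix m n ℂ} {c : ℂ}
    (hB : Bᴴ * B = c • (1 : Matrix n n ℂ)) (S : Matrix n n ℂ) (z : ℂ) :
    (B * S * Bᴴ + z • (1 : Matrix m m ℂ)) * B = B * (c • S + z • (1 : Matrix n n ℂ)) := by
  simp only [Matrix.mul_add, Matrix.add_mul, Matrix.mul_assoc, hB, Matrix.smul_mul,
    Matrix.mul_smul, Matrix.one_mul, Matrix.mul_one]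

end Matrix

/-- High-SNR limit of the pilot-contamination term in the error
covariance of the misspecified MMSE estimator: with `M = B_k·D·Sg·Dᴴ·B_kᴴ`,
as `ε → 0⁺`,
`Sg·Dᴴ·B_kᴴ·(M+εI)⁻¹·B_j·Sr·B_jᴴ·(M+εI)⁻¹·B_k·D·Sg →
  (1/L²)·D⁻¹·B_kᴴ·B_j·Sr·B_jᴴ·B_k·(Dᴴ)⁻¹`.
In particular the limit is `0` when `B_kᴴB_j = 0` and equals `D⁻¹·Sr·(Dᴴ)⁻¹`
when `B_j = B_k`. -/
theorem stmt_14 (L N : ℕ) (hN : 0 < N) (hL : 0 < L) (hNL : N ≤ L)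
    (Bk Bj : Matrix (Fin L) (Fin N) ℂ)
    (hBk : Bkᴴ * Bk = (L : ℂ) • (1 : Matrix (Fin N) (Fin N) ℂ))
    (D : Matrix (Fin N) (Fin N) ℂ) (hDdiag : D.IsDiag) (hDinv : IsUnit D.det)
    (Sg Sr : Matrix (Fin N) (Fin N) ℂ)
    (hSg : Sg.PosDef) (hSr : Sr.PosSemidef)
    (M : Matrix (Fin L) (Fin L) ℂ) (hM : M = Bk * D * Sg * Dᴴ * Bkᴴ) :
    Filter.Tendsto
      (fun ε : ℝ =>
        Sg * Dᴴ * Bkᴴ * (M + (ε : ℂ) • (1 : Matrix (Fin L) (Fin L) ℂ))⁻¹ *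
          Bj * Sr * Bjᴴ * (M + (ε : ℂ) • (1 : Matrix (Fin L) (Fin L) ℂ))⁻¹ *
          Bk * D * Sg)
      (nhdsWithin 0 (Set.Ioi 0))
      (nhds ((((L : ℂ)) ^ 2)⁻¹ • (D⁻¹ * Bkᴴ * Bj * Sr * Bjᴴ * Bk * (Dᴴ)⁻¹))) ∧
    (Bkᴴ * Bj = 0 →
      (((L : ℂ)) ^ 2)⁻¹ • (D⁻¹ * Bkᴴ * Bj * Sr * Bjᴴ * Bk * (Dᴴ)⁻¹) = 0) ∧
    (Bj = Bk →
      (((L : ℂ)) ^ 2)⁻¹ • (D⁻¹ * Bkᴴ * Bj * Sr * Bjᴴ * Bk * (Dᴴ)⁻¹) =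
        D⁻¹ * Sr * (Dᴴ)⁻¹) := by
  have hLne : (L : ℂ) ≠ 0 := Nat.cast_ne_zero.mpr hL.ne'
  have hL0 : (0 : ℂ) ≤ L := by positivity
  have hDH : IsUnit (Dᴴ).det := by rw [det_conjTranspose]; exact hDinv.star
  have hSgdet : IsUnit Sg.det := hSg.det_pos.ne'.isUnit
  refine ⟨?_, fun h => ?_, ?_⟩
  · set S : Matrix (Fin N) (Fin N) ℂ := D * Sg * Dᴴ with hS
    have hMS : M = Bk * S * Bkᴴ := by simp only [hM, hS, Matrix.mul_assoc]
    have hSpsd : S.PosSemidef := hSg.posSemidef.mul_mul_conjTranspose_same D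
    have hMpsd : M.PosSemidef := hMS ▸ hSpsd.mul_mul_conjTranspose_same Bk
    have hSdet : IsUnit ((L : ℂ) • S).det := by
      rw [det_smul, hS, det_mul, det_mul]
      exact (hLne.isUnit.pow _).mul ((hDinv.mul hSgdet).mul hDH)
    let R : ℝ → Matrix (Fin N) (Fin N) ℂ :=
      fun ε => ((L : ℂ) • S + (ε : ℂ) • (1 : Matrix (Fin N) (Fin N) ℂ))⁻¹
    have hRinv : ContinuousAt Ring.inverse ((L : ℂ) • S).det := by
      rw [Ring.inverse_eq_inv']
      exact continuousAt_inv₀ hSdet.ne_zero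
    have hRlim : Filter.Tendsto R (nhdsWithin 0 (Set.Ioi 0)) (nhds ((L : ℂ) • S)⁻¹) := by
      have hadd : Filter.Tendsto
          (fun ε : ℝ => (L : ℂ) • S + (ε : ℂ) • (1 : Matrix (Fin N) (Fin N) ℂ))
          (nhds 0) (nhds ((L : ℂ) • S)) := by
        have hc : Continuous
            (fun ε : ℝ => (L : ℂ) • S + (ε : ℂ) • (1 : Matrix (Fin N) (Fin N) ℂ)) := by
          fun_prop
        simpa using hc.tendsto 0
      exact ((continuousAt_matrix_inv _ hRinv).tendsto.comp hadd).mono_left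
        nhdsWithin_le_nhds
    have hlim : Filter.Tendsto
        (fun ε => Sg * Dᴴ * R ε * (Bkᴴ * Bj * Sr * Bjᴴ * Bk) * R ε * D * Sg)
        (nhdsWithin 0 (Set.Ioi 0))
        (nhds (Sg * Dᴴ * ((L : ℂ) • S)⁻¹ * (Bkᴴ * Bj * Sr * Bjᴴ * Bk) *
          ((L : ℂ) • S)⁻¹ * D * Sg)) :=
      ((((hRlim.const_mul (Sg * Dᴴ)).mul_const _).mul hRlim).mul_const D).mul_const Sg
    have hinv : ((L : ℂ) • S)⁻¹ = (L : ℂ)⁻¹ • ((Dᴴ)⁻¹ * (Sg⁻¹ * D⁻¹)) := by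
      apply inv_eq_right_inv
      rw [hS, Matrix.smul_mul, Matrix.mul_smul, smul_smul, mul_inv_cancel₀ hLne, one_smul,
        ← Matrix.mul_assoc, mul_nonsing_inv_cancel_right _ _ hDH, ← Matrix.mul_assoc,
        mul_nonsing_inv_cancel_right _ _ hSgdet, mul_nonsing_inv _ hDinv]
    have hleft : Sg * Dᴴ * ((L : ℂ) • S)⁻¹ = (L : ℂ)⁻¹ • D⁻¹ := by
      rw [hinv, Matrix.mul_smul, ← Matrix.mul_assoc, mul_nonsing_inv_cancel_right _ _ hDH,
        mul_nonsing_inv_cancel_left _ _ hSgdet]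
    have hright : ((L : ℂ) • S)⁻¹ * D * Sg = (L : ℂ)⁻¹ • (Dᴴ)⁻¹ := by
      rw [hinv, Matrix.smul_mul, Matrix.smul_mul, ← Matrix.mul_assoc,
        nonsing_inv_mul_cancel_right _ _ hDinv, nonsing_inv_mul_cancel_right _ _ hSgdet]
    have hval : Sg * Dᴴ * ((L : ℂ) • S)⁻¹ * (Bkᴴ * Bj * Sr * Bjᴴ * Bk) *
          ((L : ℂ) • S)⁻¹ * D * Sg =
        (((L : ℂ)) ^ 2)⁻¹ • (D⁻¹ * Bkᴴ * Bj * Sr * Bjᴴ * Bk * (Dᴴ)⁻¹) := by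
      rw [hleft, Matrix.mul_assoc _ _ D, Matrix.mul_assoc _ _ Sg, hright]
      simp only [Matrix.smul_mul, Matrix.mul_smul, smul_smul, Matrix.mul_assoc, sq, mul_inv]
    rw [← hval]
    refine hlim.congr' ?_
    filter_upwards [self_mem_nhdsWithin] with ε hε
    have hX := hMpsd.isUnit_det_add_smul_one hε
    have hY := (hSpsd.smul hL0).isUnit_det_add_smul_one hε
    have h1 : Bkᴴ * (M + (ε : ℂ) • (1 : Matrix (Fin L) (Fin L) ℂ))⁻¹ = R ε * Bkᴴ :=
      mul_inv_eq_inv_mul_of_mul_eq_mul hX hY (hMS ▸ conjTranspose_mul_add_smul_one hBk S ε)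
    have h2 : Bk * R ε = (M + (ε : ℂ) • (1 : Matrix (Fin L) (Fin L) ℂ))⁻¹ * Bk :=
      mul_inv_eq_inv_mul_of_mul_eq_mul hY hX (hMS ▸ (add_smul_one_mul hBk S ε).symm)
    rw [Matrix.mul_assoc (Sg * Dᴴ) Bkᴴ, h1]
    simp only [Matrix.mul_assoc]
    rw [← Matrix.mul_assoc _ Bk (D * Sg), ← h2, Matrix.mul_assoc]
  · simp only [Matrix.mul_assoc D⁻¹, h, Matrix.mul_zero, Matrix.zero_mul, smul_zero]
  · rintro rfl
    simp only [Matrix.mul_assoc D⁻¹, hBk]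
    simp only [Matrix.mul_assoc _ Bjᴴ, hBk]
    simp only [Matrix.smul_mul, Matrix.mul_smul, Matrix.mul_one, Matrix.one_mul, smul_smul]
    rw [show ((L : ℂ) ^ 2)⁻¹ * ((L : ℂ) * L) = 1 by field_simp, one_smul]
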